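/- For every d > 0 and every ε > 0 there is a constant C such that for every connected undirected unweighted graph G on n vertices and every subset S of vertices, there exists a subgraph H of G satisfying δ_H(u,v) ≤ δ_G(u,v) + n^d for all u,v ∈ S, with at most C·(n^{1+ε} + |S|^{3/4}·n^{1−d/2+ε}) edges. -/

import Mathlib

namespace SubSpan
open Finset Classical
set_option linter.unusedSectionVars false
set_option linter.unusedVariables false

/-- There is a walk in `H` from `x` to `y` of length at most `l`. -/
def R {V : Type} (H : SimpleGraph V) (x y : V) (l : ℕ) : Prop := ∃ p : H.Walk x y, p.length ≤ l

section R
variable {V : Type} {H H' : SimpleGraph V} {x y z : V} {l l' : ℕ}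

lemma R.refl (H : SimpleGraph V) (x : V) : R H x x 0 := ⟨SimpleGraph.Walk.nil, by simp⟩
lemma R.symm (h : R H x y l) : R H y x l := by
  obtain ⟨p, hp⟩ := h
  exact ⟨p.reverse, by simpa using hp⟩
lemma R.trans (h : R H x y l) (h' : R H y z l') : R H x z (l + l') := by
  obtain ⟨p, hp⟩ := h
  obtain ⟨q, hq⟩ := h'
  exact ⟨p.append q, by simp; omega⟩
lemma R.mono (h : R H x y l) (hl : l ≤ l') : R H x y l' := by
  obtain ⟨p, hp⟩ := h
  exact ⟨p, hp.trans hl⟩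
lemma R.monoH (h : R H x y l) (hl : H ≤ H') : R H' x y l := by
  obtain ⟨p, hp⟩ := h
  exact ⟨p.mapLe hl, by simpa using hp⟩
lemma R.adj (h : H.Adj x y) : R H x y 1 := ⟨h.toWalk, by simp⟩
lemma R.dist_le (h : R H x y l) : H.dist x y ≤ l := by
  obtain ⟨p, hp⟩ := h
  exact (SimpleGraph.dist_le p).trans hp
end R

variable {V : Type} [Fintype V] {G : SimpleGraph V}

/-- `P` is the vertex set of a shortest path from `u` to `v`. -/
structure IsGeo (G : SimpleGraph V) (u v : V) (P : Finset V) : Prop where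
  on : ∀ x ∈ P, G.dist u x + G.dist x v = G.dist u v
  surj : ∀ t ≤ G.dist u v, ∃ x ∈ P, G.dist u x = t
  met : ∀ x ∈ P, ∀ y ∈ P, G.dist u x ≤ G.dist u y → G.dist u x + G.dist x y = G.dist u y

lemma walk_dist {u v : V} (hG : G.Connected) (p : G.Walk u v) (i k : ℕ) :
    G.dist (p.getVert i) (p.getVert (i + k)) ≤ k := by
  induction k with
  | zero => simp
  | succ k ih =>
    have h1 : G.dist (p.getVert (i + k)) (p.getVert (i + k + 1)) ≤ 1 := by
      by_cases h : i + k < p.length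
      · exact (SimpleGraph.dist_eq_one_iff_adj.mpr (p.adj_getVert_succ h)).le
      · rw [p.getVert_of_length_le (by omega), p.getVert_of_length_le (by omega)]; simp
    have := hG.dist_triangle (u := p.getVert i) (v := p.getVert (i+k)) (w := p.getVert (i+k+1))
    rw [← add_assoc]; omega

lemma exists_isGeo (hG : G.Connected) (u v : V) : ∃ P, IsGeo G u v P := by
  obtain ⟨p, hp⟩ := hG.exists_walk_length_eq_dist u v
  have key : ∀ i ≤ p.length, G.dist u (p.getVert i) = i ∧ G.dist (p.getVert i) v = p.length - i := by
    intro i hi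
    have h1 := walk_dist hG p 0 i
    have h2 := walk_dist hG p i (p.length - i)
    have h3 := hG.dist_triangle (u := u) (v := p.getVert i) (w := v)
    rw [show i + (p.length - i) = p.length by omega] at h2
    simp at h1 h2
    omega
  refine ⟨(Finset.range (p.length+1)).image p.getVert, ?_, ?_, ?_⟩
  · intro x hx
    simp only [Finset.mem_image, Finset.mem_range] at hx
    obtain ⟨i, hi, rfl⟩ := hx
    have := key i (by omega)
    omega
  · intro t ht
    refine ⟨p.getVert t, ?_, (key t (by omega)).1⟩
    simp only [Finset.mem_image, Finset.mem_range]
    exact ⟨t, by omega, rfl⟩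
  · intro x hx y hy hxy
    simp only [Finset.mem_image, Finset.mem_range] at hx hy
    obtain ⟨i, hi, rfl⟩ := hx
    obtain ⟨j, hj, rfl⟩ := hy
    have h1 := (key i (by omega)).1
    have h2 := (key j (by omega)).1
    have h3 := walk_dist hG p i (j - i)
    rw [show i + (j-i) = j by omega] at h3
    have h4 := hG.dist_triangle (u := u) (v := p.getVert i) (w := p.getVert j)
    omega

/-- Weight of a vertex set; distinct sets have distinct weights. -/
noncomputable def wt (P : Finset V) : ℕ := ∑ x ∈ P, 2 ^ (Fintype.equivFin V x : ℕ)

lemma wt_inj {P Q : Finset V} (h : wt P = wt Q) : P = Q := by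
  have hinj : Function.Injective (fun x : V => (Fintype.equivFin V x : ℕ)) :=
    Fin.val_injective.comp (Fintype.equivFin V).injective
  have : P.image (fun x : V => (Fintype.equivFin V x : ℕ)) =
      Q.image (fun x : V => (Fintype.equivFin V x : ℕ)) := by
    apply Finset.geomSum_injective (le_refl 2)
    simp only
    rw [Finset.sum_image (fun a _ b _ h => hinj h), Finset.sum_image (fun a _ b _ h => hinj h)]
    exact h
  exact Finset.image_injective hinj this

lemma exists_min_geo (hG : G.Connected) (u v : V) :
    ∃ P, IsGeo G u v P ∧ ∀ Q, IsGeo G u v Q → wt P ≤ wt Q := by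
  obtain ⟨P0, hP0⟩ := exists_isGeo hG u v
  obtain ⟨P, hP, hm⟩ := Finset.exists_min_image (Finset.univ.filter (IsGeo G u v)) wt
    ⟨P0, by simpa using hP0⟩
  exact ⟨P, by simpa using hP, fun Q hQ => hm Q (by simpa using hQ)⟩

/-- The canonical shortest path (as a vertex set). -/
noncomputable def geo (hG : G.Connected) (u v : V) : Finset V := (exists_min_geo hG u v).choose
lemma geo_is (hG : G.Connected) (u v : V) : IsGeo G u v (geo hG u v) :=
  (exists_min_geo hG u v).choose_spec.1
lemma geo_min (hG : G.Connected) (u v : V) {Q} (h : IsGeo G u v Q) : wt (geo hG u v) ≤ wt Q :=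
  (exists_min_geo hG u v).choose_spec.2 Q h

lemma IsGeo.symm (hG : G.Connected) {u v : V} {P} (h : IsGeo G u v P) : IsGeo G v u P := by
  have c := G.dist_comm (u := u) (v := v)
  refine ⟨?_, ?_, ?_⟩
  · intro x hx
    have := h.on x hx
    rw [G.dist_comm (u := v), G.dist_comm (u := x) (v := u)]; omega
  · intro t ht
    obtain ⟨x, hx, h1⟩ := h.surj (G.dist u v - t) (by omega)
    refine ⟨x, hx, ?_⟩
    have := h.on x hx
    rw [G.dist_comm (u := v)]; omega
  · intro x hx y hy hxy
    have h1 := h.on x hx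
    have h2 := h.on y hy
    rw [G.dist_comm (u := v), G.dist_comm (u := v) (v := y)] at *
    have := h.met y hy x hx (by omega)
    rw [G.dist_comm (u := x) (v := y)]; omega

lemma geo_symm (hG : G.Connected) (u v : V) : geo hG u v = geo hG v u :=
  wt_inj (le_antisymm (geo_min hG u v ((geo_is hG v u).symm hG))
    (geo_min hG v u ((geo_is hG u v).symm hG)))

lemma IsGeo.uniq (hG : G.Connected) {u v x y : V} {P} (h : IsGeo G u v P) (hx : x ∈ P) (hy : y ∈ P)
    (e : G.dist u x = G.dist u y) : x = y := by
  have := h.met x hx y hy e.le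
  exact hG.dist_eq_zero_iff.mp (by omega)

lemma geo_seg (hG : G.Connected) {u v x y : V} (hx : x ∈ geo hG u v) (hy : y ∈ geo hG u v)
    (hxy : G.dist u x ≤ G.dist u y) :
    geo hG x y = (geo hG u v).filter (fun z => G.dist u x ≤ G.dist u z ∧ G.dist u z ≤ G.dist u y) := by
  set I := geo hG u v with hI
  set J := geo hG x y with hJ
  have I1 : IsGeo G u v I := geo_is hG u v
  have J1 : IsGeo G x y J := geo_is hG x y
  set Sg := I.filter (fun z => G.dist u x ≤ G.dist u z ∧ G.dist u z ≤ G.dist u y) with hS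
  have exy := I1.met x hx y hy hxy
  have eyv := I1.on y hy
  have exv := I1.on x hx
  have tri := fun a b c => hG.dist_triangle (u := a) (v := b) (w := c)
  have S1 : IsGeo G x y Sg := by
    refine ⟨?_, ?_, ?_⟩
    · intro z hz
      simp only [hS, mem_filter] at hz
      have h1 := I1.met x hx z hz.1 hz.2.1
      have h2 := I1.met z hz.1 y hy hz.2.2
      omega
    · intro t ht
      obtain ⟨z, hz, h1⟩ := I1.surj (G.dist u x + t) (by omega)
      have h2 := I1.met x hx z hz (by omega)
      refine ⟨z, ?_, by omega⟩
      simp only [hS, mem_filter]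
      exact ⟨hz, by omega, by omega⟩
    · intro z hz w hw hzw
      simp only [hS, mem_filter] at hz hw
      have h1 := I1.met x hx z hz.1 hz.2.1
      have h2 := I1.met x hx w hw.1 hw.2.1
      have h3 := I1.met z hz.1 w hw.1 (by omega)
      omega
  have Jpos : ∀ z ∈ J, G.dist u z = G.dist u x + G.dist x z ∧ G.dist z v = G.dist z y + G.dist y v := by
    intro z hz
    have h1 := J1.on z hz
    have h2 := tri u x z
    have h3 := tri z y v
    have h4 := tri u z v
    omega
  have K1 : IsGeo G u v ((I \ Sg) ∪ J) := by
    have mem : ∀ z, z ∈ (I \ Sg) ∪ J → (z ∈ I ∧ (G.dist u z < G.dist u x ∨ G.dist u y < G.dist u z)) ∨ z ∈ J := by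
      intro z hz
      simp only [hS, mem_union, mem_sdiff, mem_filter] at hz
      rcases hz with ⟨h1, h2⟩ | h
      · left; refine ⟨h1, ?_⟩
        by_contra h
        exact h2 ⟨h1, by omega, by omega⟩
      · exact Or.inr h
    refine ⟨?_, ?_, ?_⟩
    · intro z hz
      rcases mem z hz with h | h
      · exact I1.on z h.1
      · have h1 := Jpos z h
        have h2 := J1.on z h
        omega
    · intro t ht
      by_cases h : G.dist u x ≤ t ∧ t ≤ G.dist u y
      · obtain ⟨z, hz, h1⟩ := J1.surj (t - G.dist u x) (by omega)
        refine ⟨z, mem_union_right _ hz, ?_⟩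
        have := (Jpos z hz).1
        omega
      · obtain ⟨z, hz, h1⟩ := I1.surj t ht
        refine ⟨z, mem_union_left _ ?_, h1⟩
        simp only [hS, mem_sdiff, mem_filter]
        refine ⟨hz, ?_⟩
        rw [h1]; tauto
    · intro z hz w hw hzw
      have t0 := tri u z w
      rcases mem z hz with ⟨h1, h2⟩ | h1 <;> rcases mem w hw with ⟨h3, h4⟩ | h3
      · exact I1.met z h1 w h3 hzw
      · have p := Jpos w h3
        have q := J1.on w h3
        have a := I1.met z h1 x hx (by omega)
        have b := tri z x w
        omega
      · have p := Jpos z h1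
        have q := J1.on z h1
        have a := I1.met y hy w h3 (by omega)
        have b := tri z y w
        omega
      · have p := Jpos z h1
        have q := Jpos w h3
        have := J1.met z h1 w h3 (by omega)
        omega
  have dis : Disjoint (I \ Sg) J := by
    rw [Finset.disjoint_left]
    intro z hz hzJ
    have p := Jpos z hzJ
    have q := J1.on z hzJ
    simp only [hS, mem_sdiff, mem_filter] at hz
    exact hz.2 ⟨hz.1, by omega, by omega⟩
  have w1 : wt I ≤ wt ((I \ Sg) ∪ J) := geo_min hG u v K1
  have w2 : wt J ≤ wt Sg := geo_min hG x y S1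
  have w3 : wt ((I \ Sg) ∪ J) = wt (I \ Sg) + wt J := Finset.sum_union dis
  have w4 : wt (I \ Sg) + wt Sg = wt I := Finset.sum_sdiff (Finset.filter_subset _ _)
  exact wt_inj (by omega)

lemma geo_sub (hG : G.Connected) {u v x y : V} (hx : x ∈ geo hG u v) (hy : y ∈ geo hG u v) :
    geo hG x y ⊆ geo hG u v := by
  rcases le_total (G.dist u x) (G.dist u y) with h | h
  · rw [geo_seg hG hx hy h]; exact Finset.filter_subset _ _
  · rw [geo_symm, geo_seg hG hy hx h]; exact Finset.filter_subset _ _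

/-- neighbours within a geodesic -/
lemma geo_adj (hG : G.Connected) {u v x y : V} (hx : x ∈ geo hG u v) (hy : y ∈ geo hG u v)
    (h : G.Adj x y) : G.dist u y = G.dist u x + 1 ∨ G.dist u y + 1 = G.dist u x := by
  have e := SimpleGraph.dist_eq_one_iff_adj.mpr h
  rcases le_total (G.dist u x) (G.dist u y) with h | h
  · have := (geo_is hG u v).met x hx y hy h; omega
  · have := (geo_is hG u v).met y hy x hx h
    rw [G.dist_comm] at e; omega

lemma geo_deg (hG : G.Connected) {u v x : V} (hx : x ∈ geo hG u v) :
    ((geo hG u v).filter (fun y => G.Adj x y)).card ≤ 2 := by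
  have h : ((geo hG u v).filter (fun y => G.Adj x y)).image (G.dist u) ⊆
      {G.dist u x + 1, G.dist u x - 1} := by
    intro t ht
    simp only [mem_image, mem_filter] at ht
    obtain ⟨y, ⟨hy, ha⟩, rfl⟩ := ht
    have := geo_adj hG hx hy ha
    simp only [mem_insert, mem_singleton]; omega
  rw [← Finset.card_image_of_injOn (f := G.dist u)]
  · exact (Finset.card_le_card h).trans Finset.card_le_two
  · intro a ha b hb e
    simp only [coe_filter, Set.mem_ofPred_eq] at ha hb
    exact (geo_is hG u v).uniq hG ha.1 hb.1 e

/-- two geodesics branch at most twice -/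
lemma geo_branch (hG : G.Connected) (a b u v : V) :
    ((Finset.univ : Finset (V × V)).filter (fun q => q.1 ∈ geo hG a b ∧ q.1 ∈ geo hG u v ∧
      q.2 ∈ geo hG u v ∧ q.2 ∉ geo hG a b ∧ G.Adj q.1 q.2)).card ≤ 2 := by
  set X := ((Finset.univ : Finset (V × V)).filter (fun q => q.1 ∈ geo hG a b ∧ q.1 ∈ geo hG u v ∧
      q.2 ∈ geo hG u v ∧ q.2 ∉ geo hG a b ∧ G.Adj q.1 q.2)) with hX
  have hb : ∀ x ∈ geo hG u v, ∀ y ∈ geo hG u v, ∀ z ∈ geo hG u v, x ∈ geo hG a b → y ∈ geo hG a b →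
      G.dist u x ≤ G.dist u z → G.dist u z ≤ G.dist u y → z ∈ geo hG a b := by
    intro x hx y hy z hz hxa hya h1 h2
    apply geo_sub hG hxa hya
    rw [geo_seg hG hx hy (h1.trans h2)]
    simp [hz, h1, h2]
  have inj : Set.InjOn (fun q : V × V => decide (G.dist u q.1 ≤ G.dist u q.2)) (X : Set (V × V)) := by
    rintro ⟨x, z⟩ hq ⟨y, w⟩ hq' e
    simp only [hX, coe_filter, Set.mem_ofPred_eq, mem_univ, true_and] at hq hq'
    simp only [decide_eq_decide] at e
    obtain ⟨x1, x2, z2, z1, hxz⟩ := hq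
    obtain ⟨y1, y2, w2, w1, hyw⟩ := hq'
    have e1 := geo_adj hG x2 z2 hxz
    have e2 := geo_adj hG y2 w2 hyw
    have c1 := hb x x2 y y2 z z2 x1 y1
    have c2 := hb y y2 x x2 z z2 y1 x1
    have c3 := hb x x2 y y2 w w2 x1 y1
    have c4 := hb y y2 x x2 w w2 y1 x1
    have : G.dist u x = G.dist u y := by
      by_contra hne
      have c1' : ¬ (G.dist u x ≤ G.dist u z ∧ G.dist u z ≤ G.dist u y) := fun h => z1 (c1 h.1 h.2)
      have c2' : ¬ (G.dist u y ≤ G.dist u z ∧ G.dist u z ≤ G.dist u x) := fun h => z1 (c2 h.1 h.2)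
      have c3' : ¬ (G.dist u x ≤ G.dist u w ∧ G.dist u w ≤ G.dist u y) := fun h => w1 (c3 h.1 h.2)
      have c4' : ¬ (G.dist u y ≤ G.dist u w ∧ G.dist u w ≤ G.dist u x) := fun h => w1 (c4 h.1 h.2)
      omega
    have t1 := (geo_is hG u v).uniq hG x2 y2 this
    have t2 := (geo_is hG u v).uniq hG z2 w2 (by omega)
    rw [t1, t2]
  calc X.card ≤ (Finset.univ : Finset Bool).card := Finset.card_le_card_of_injOn _ (fun _ _ => Finset.mem_coe.mpr (mem_univ _)) inj
    _ = 2 := by simp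


/-- darts spanned by a family of geodesics -/
noncomputable def darts (hG : G.Connected) (T : Finset (V × V)) : Finset (V × V) :=
  Finset.univ.filter (fun q : V × V => G.Adj q.1 q.2 ∧
    ∃ p ∈ T, q.1 ∈ geo hG p.1 p.2 ∧ q.2 ∈ geo hG p.1 p.2)

/-- Coppersmith-Elkin counting -/
lemma ce_nat (hG : G.Connected) (B : Finset V) (T : Finset (V × V))
    (hT : ∀ p ∈ T, geo hG p.1 p.2 ⊆ B) :
    (darts hG T).card ^ 2 ≤ B.card * (2 * (darts hG T).card + 8 * T.card ^ 2) := by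
  set D := darts hG T with hD
  have memD : ∀ q, q ∈ D ↔ G.Adj q.1 q.2 ∧
    ∃ p ∈ T, q.1 ∈ geo hG p.1 p.2 ∧ q.2 ∈ geo hG p.1 p.2 := by
    intro q; simp [hD, darts]
  have hown : ∀ q, ∃ p, q ∈ D → p ∈ T ∧ (q.1 ∈ geo hG p.1 p.2 ∧ q.2 ∈ geo hG p.1 p.2) ∧
      ∀ p' ∈ T, (q.1 ∈ geo hG p'.1 p'.2 ∧ q.2 ∈ geo hG p'.1 p'.2) →
        Fintype.equivFin (V × V) p ≤ Fintype.equivFin (V × V) p' := by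
    intro q
    by_cases hq : q ∈ D
    · obtain ⟨p0, hp0, h0⟩ := ((memD q).mp hq).2
      obtain ⟨p, hp, hm⟩ := Finset.exists_min_image
        (T.filter (fun p => q.1 ∈ geo hG p.1 p.2 ∧ q.2 ∈ geo hG p.1 p.2))
        (Fintype.equivFin (V × V)) ⟨p0, by simp [hp0, h0]⟩
      simp only [mem_filter] at hp hm
      exact ⟨p, fun _ => ⟨hp.1, hp.2, fun p' h1 h2 => hm p' ⟨h1, h2⟩⟩⟩
    · exact ⟨q, fun h => absurd h hq⟩
  choose own hown using hown
  set N : V → Finset V := fun v => Finset.univ.filter (fun z => (v, z) ∈ D) with hN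
  set X : Finset (V × V × V) := Finset.univ.filter
    (fun t => (t.1, t.2.1) ∈ D ∧ (t.1, t.2.2) ∈ D) with hX
  have fstB : ∀ q ∈ D, q.1 ∈ B := by
    intro q hq
    obtain ⟨p, hp, h1, _⟩ := ((memD q).mp hq).2
    exact hT p hp h1
  have cD : D.card = ∑ v ∈ B, (N v).card := by
    rw [Finset.card_eq_sum_card_fiberwise (f := Prod.fst) (t := B) (fun q hq => fstB q hq)]
    apply Finset.sum_congr rfl
    intro v _
    symm
    apply Finset.card_bij (fun z _ => (v, z))
    · intro z hz; simpa [hN] using hz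
    · intro a _ b _ h; simpa using h
    · rintro ⟨x, z⟩ hq
      simp only [mem_filter] at hq
      obtain ⟨h1, rfl⟩ := hq
      exact ⟨z, by simpa [hN] using h1, rfl⟩
  have cX : ∑ v ∈ B, (N v).card ^ 2 ≤ X.card := by
    rw [Finset.card_eq_sum_card_fiberwise (s := X) (f := Prod.fst) (t := B)
      (fun q hq => fstB (q.1, q.2.1) (by simp [hX] at hq; exact hq.1))]
    apply Finset.sum_le_sum
    intro v _
    rw [sq, ← Finset.card_product]
    apply Finset.card_le_card_of_injOn (fun z => (v, z))
    · intro z hz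
      simp [hN] at hz
      simp [hX, hz]
    · intro a _ b _ h; simpa using h
  have cs : D.card ^ 2 ≤ B.card * X.card := by
    rw [cD]
    exact sq_sum_le_card_mul_sum_sq.trans (Nat.mul_le_mul_left _ cX)
  set nb : V × V → V → Finset V := fun p x => (geo hG p.1 p.2).filter (fun y => G.Adj x y) with hnb
  set br : V × V → V × V → Finset (V × V) := fun p p' => (Finset.univ : Finset (V × V)).filter
    (fun q => q.1 ∈ geo hG p.1 p.2 ∧ q.1 ∈ geo hG p'.1 p'.2 ∧
      q.2 ∈ geo hG p'.1 p'.2 ∧ q.2 ∉ geo hG p.1 p.2 ∧ G.Adj q.1 q.2) with hbr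
  set S0 : Finset (V × V × V) := D.biUnion (fun q => (nb (own q) q.1).image (fun z => (q.1, q.2, z))) with hS0
  set Y1 : Finset (V × V × V) := (T ×ˢ T).biUnion (fun pp => (br pp.1 pp.2).biUnion (fun q =>
    (nb pp.1 q.1).image (fun z => (q.1, z, q.2)))) with hY1
  set Y2 : Finset (V × V × V) := (T ×ˢ T).biUnion (fun pp => (br pp.1 pp.2).biUnion (fun q =>
    (nb pp.1 q.1).image (fun z => (q.1, q.2, z)))) with hY2
  have cS0 : S0.card ≤ D.card * 2 := by
    apply Finset.card_biUnion_le_card_mul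
    intro q hq
    exact Finset.card_image_le.trans (geo_deg hG (hown q hq).2.1.1)
  have cbr : ∀ p p', (br p p').card ≤ 2 := fun p p' => geo_branch hG _ _ _ _
  have cY1 : Y1.card ≤ T.card * T.card * 4 := by
    rw [← Finset.card_product]
    apply Finset.card_biUnion_le_card_mul
    intro pp _
    refine (Finset.card_biUnion_le_card_mul _ _ 2 ?_).trans ?_
    · intro q hq
      simp only [hbr, mem_filter] at hq
      exact Finset.card_image_le.trans (geo_deg hG hq.2.1)
    · have := cbr pp.1 pp.2; omega
  have cY2 : Y2.card ≤ T.card * T.card * 4 := by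
    rw [← Finset.card_product]
    apply Finset.card_biUnion_le_card_mul
    intro pp _
    refine (Finset.card_biUnion_le_card_mul _ _ 2 ?_).trans ?_
    · intro q hq
      simp only [hbr, mem_filter] at hq
      exact Finset.card_image_le.trans (geo_deg hG hq.2.1)
    · have := cbr pp.1 pp.2; omega
  have sub : X ⊆ S0 ∪ (Y1 ∪ Y2) := by
    rintro ⟨v, z1, z2⟩ ht
    simp only [hX, mem_filter, mem_univ, true_and] at ht
    obtain ⟨h1, h2⟩ := ht
    obtain ⟨o1, ⟨a1, b1⟩, m1⟩ := hown _ h1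
    obtain ⟨o2, ⟨a2, b2⟩, m2⟩ := hown _ h2
    have d1 := ((memD _).mp h1).1
    have d2 := ((memD _).mp h2).1
    simp only at a1 b1 a2 b2 d1 d2 m1 m2
    set p1 := own (v, z1)
    set p2 := own (v, z2)
    rw [mem_union, mem_union]
    by_cases e : p1 = p2
    · left
      simp only [hS0, mem_biUnion, mem_image]
      refine ⟨(v, z1), h1, z2, ?_, rfl⟩
      simp only [hnb, mem_filter]
      refine ⟨?_, d2⟩
      change z2 ∈ geo hG p1.1 p1.2
      rw [e]; exact b2
    · right
      rcases le_total (Fintype.equivFin (V × V) p1) (Fintype.equivFin (V × V) p2) with hl | hl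
      · left
        have hz : z2 ∉ geo hG p1.1 p1.2 := fun hz => e ((Fintype.equivFin (V × V)).injective
          (le_antisymm hl (m2 p1 o1 ⟨a1, hz⟩)))
        simp only [hY1, mem_biUnion, mem_image, mem_product]
        refine ⟨(p1, p2), ⟨o1, o2⟩, (v, z2), ?_, z1, ?_, rfl⟩
        · simp only [hbr, mem_filter, mem_univ, true_and]; exact ⟨a1, a2, b2, hz, d2⟩
        · simp only [hnb, mem_filter]; exact ⟨b1, d1⟩
      · right
        have hz : z1 ∉ geo hG p2.1 p2.2 := fun hz => e ((Fintype.equivFin (V × V)).injective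
          (le_antisymm (m1 p2 o2 ⟨a2, hz⟩) hl))
        simp only [hY2, mem_biUnion, mem_image, mem_product]
        refine ⟨(p2, p1), ⟨o2, o1⟩, (v, z1), ?_, z2, ?_, rfl⟩
        · simp only [hbr, mem_filter, mem_univ, true_and]; exact ⟨a2, a1, b1, hz, d1⟩
        · simp only [hnb, mem_filter]; exact ⟨b2, d2⟩
  have cc : X.card ≤ 2 * D.card + 8 * T.card ^ 2 := by
    have h1 := Finset.card_le_card sub
    have h2 := Finset.card_union_le S0 (Y1 ∪ Y2)
    have h3 := Finset.card_union_le Y1 Y2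
    rw [sq]; omega
  exact cs.trans (Nat.mul_le_mul_left _ cc)

lemma ce (hG : G.Connected) (B : Finset V) (T : Finset (V × V))
    (hT : ∀ p ∈ T, geo hG p.1 p.2 ⊆ B) :
    ((darts hG T).card : ℝ) ≤ 2 * B.card + 3 * T.card * Real.sqrt B.card := by
  have h : ((darts hG T).card : ℝ) ^ 2 ≤
    B.card * (2 * (darts hG T).card + 8 * (T.card : ℝ) ^ 2) := by exact_mod_cast ce_nat hG B T hT
  have hs : Real.sqrt B.card ^ 2 = B.card := Real.sq_sqrt (by positivity)
  have hs0 := Real.sqrt_nonneg (B.card : ℝ)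
  have hp : (0:ℝ) ≤ T.card := by positivity
  have hd : (0:ℝ) ≤ (darts hG T).card := by positivity
  have hb : (0:ℝ) ≤ B.card := by positivity
  generalize ((darts hG T).card : ℝ) = D at *
  generalize (T.card : ℝ) = p at *
  generalize Real.sqrt (B.card : ℝ) = w at *
  generalize (B.card : ℝ) = N at *
  by_contra hc
  push Not at hc
  have hpw : 0 ≤ p * w := mul_nonneg hp hs0
  have h1 : 0 < D := by nlinarith
  have h2 : D * (3 * p * w) < D * (D - 2 * N) := mul_lt_mul_of_pos_left (by linarith) h1
  have h3 : (3 * p * w) * (3 * p * w) ≤ D * (3 * p * w) :=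
    mul_le_mul_of_nonneg_right (by linarith) (by nlinarith)
  subst hs
  nlinarith [sq_nonneg (p * w)]

/-- balls -/
noncomputable def ball (G : SimpleGraph V) (c : V) (ρ : ℕ) : Finset V :=
  Finset.univ.filter (fun x => G.dist c x ≤ ρ)

lemma mem_ball {c x : V} {ρ : ℕ} : x ∈ ball G c ρ ↔ G.dist c x ≤ ρ := by simp [ball]

lemma growth (c : V) (k r : ℕ) (hk : 0 < k) :
    ∃ i < k, ((ball G c (8 ^ (i + 1) * r)).card : ℝ) ≤
      (Fintype.card V : ℝ) ^ ((1 : ℝ) / k) * (ball G c (8 ^ i * r)).card := by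
  by_contra hc
  push Not at hc
  set q := (Fintype.card V : ℝ) ^ ((1 : ℝ) / k) with hq
  have hV : 0 < Fintype.card V := Fintype.card_pos_iff.mpr ⟨c⟩
  have hq0 : 0 < q := by positivity
  have ih : ∀ i ≤ k, q ^ i ≤ (ball G c (8 ^ i * r)).card := by
    intro i
    induction i with
    | zero =>
      intro _
      have : 0 < (ball G c (8 ^ 0 * r)).card := Finset.card_pos.mpr ⟨c, by simp [mem_ball]⟩
      simpa using this
    | succ i ih =>
      intro hi
      rw [pow_succ, mul_comm]
      exact (mul_le_mul_of_nonneg_left (ih (by omega)) hq0.le).trans (hc i (by omega)).le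
  obtain ⟨m, rfl⟩ : ∃ m, k = m + 1 := ⟨k - 1, by omega⟩
  have h1 := hc m (by omega)
  have h2 := mul_le_mul_of_nonneg_left (ih m (by omega)) hq0.le
  have h3 : q * q ^ m = Fintype.card V := by
    rw [← pow_succ', hq, ← Real.rpow_natCast, ← Real.rpow_mul (by positivity)]
    rw [one_div, inv_mul_cancel₀ (by positivity), Real.rpow_one]
  have h4 : ((ball G c (8 ^ (m + 1) * r)).card : ℝ) ≤ Fintype.card V := by
    exact_mod_cast Finset.card_le_univ _
  linarith

lemma clusters (hG : G.Connected) (k r : ℕ) (hk : 0 < k) :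
    ∃ (C : Finset V) (ρ : V → ℕ), (∀ c ∈ C, r ≤ ρ c ∧ 8 * ρ c ≤ 8 ^ k * r) ∧
      (∀ x, ∃ c ∈ C, G.dist c x ≤ 3 * ρ c) ∧
      (∑ c ∈ C, ((ball G c (8 * ρ c)).card : ℝ)) ≤ (Fintype.card V : ℝ) ^ (1 + (1 : ℝ) / k) := by
  choose i hi hg using fun c : V => growth (G := G) c k r hk
  have hV : 0 < Fintype.card V := Fintype.card_pos_iff.mpr hG.nonempty
  have hρ : ∀ c, 8 ^ i c * r ≤ 8 ^ k * r := fun c =>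
    Nat.mul_le_mul_right _ (Nat.pow_le_pow_right (by norm_num) (hi c).le)
  obtain ⟨u, -, hdis, hcov⟩ := Vitali.exists_disjoint_subfamily_covering_enlargement
    (fun c : V => (ball G c (8 ^ i c * r) : Set V)) Set.univ (fun c => ((8 ^ i c * r : ℕ) : ℝ)) 2
    (by norm_num) (fun _ _ => by positivity) ((8 ^ k * r : ℕ) : ℝ) (fun c _ => by exact_mod_cast hρ c)
    (fun c _ => ⟨c, by simp [mem_ball]⟩)
  refine ⟨u.toFinset, fun c => 8 ^ i c * r, ?_, ?_, ?_⟩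
  · intro c _
    constructor
    · exact Nat.le_mul_of_pos_left _ (by positivity)
    · rw [← mul_assoc, ← pow_succ']
      exact Nat.mul_le_mul_right _ (Nat.pow_le_pow_right (by norm_num) (hi c))
  · intro x
    obtain ⟨c, hc, ⟨z, hz1, hz2⟩, hl⟩ := hcov x (Set.mem_univ _)
    refine ⟨c, by simpa using hc, ?_⟩
    simp only [mem_coe, mem_ball] at hz1 hz2
    have hl' : 8 ^ i x * r ≤ 2 * (8 ^ i c * r) := by exact_mod_cast hl
    have := hG.dist_triangle (u := c) (v := z) (w := x)
    rw [G.dist_comm] at hz1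
    change G.dist c x ≤ 3 * (8 ^ i c * r)
    omega
  · have h1 : ∑ c ∈ u.toFinset, (ball G c (8 ^ i c * r)).card ≤ Fintype.card V := by
      rw [← Finset.card_biUnion]
      · exact Finset.card_le_univ _
      · intro a ha b hb hab
        have := hdis (by simpa using ha) (by simpa using hb) hab
        simpa [Function.onFun] using this
    calc (∑ c ∈ u.toFinset, ((ball G c (8 * (8 ^ i c * r))).card : ℝ))
        ≤ ∑ c ∈ u.toFinset, (Fintype.card V : ℝ) ^ ((1 : ℝ) / k) * (ball G c (8 ^ i c * r)).card := by
          apply Finset.sum_le_sum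
          intro c _
          have := hg c
          rwa [pow_succ', mul_assoc] at this
      _ = (Fintype.card V : ℝ) ^ ((1 : ℝ) / k) * ((∑ c ∈ u.toFinset, (ball G c (8 ^ i c * r)).card : ℕ) : ℝ) := by
          rw [← Finset.mul_sum]; push_cast; rfl
      _ ≤ (Fintype.card V : ℝ) ^ ((1 : ℝ) / k) * Fintype.card V := by
          apply mul_le_mul_of_nonneg_left _ (by positivity)
          exact_mod_cast h1
      _ = _ := by rw [add_comm, Real.rpow_add_one (by positivity)]

lemma layer (c : V) (ρ : ℕ) (hρ : 0 < ρ) :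
    ∃ t, 3 * ρ < t ∧ t ≤ 4 * ρ ∧
      (Finset.univ.filter (fun x => G.dist c x = t)).card * ρ ≤ (ball G c (8 * ρ)).card := by
  by_contra hc
  push Not at hc
  have h1 : ∑ t ∈ Finset.Ioc (3 * ρ) (4 * ρ), (Finset.univ.filter (fun x => G.dist c x = t)).card
      ≤ (ball G c (8 * ρ)).card := by
    rw [← Finset.card_biUnion]
    · apply Finset.card_le_card
      intro x hx
      simp only [mem_biUnion, mem_filter, mem_univ, true_and, mem_Ioc] at hx
      obtain ⟨t, ht, e⟩ := hx
      rw [mem_ball]; omega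
    · intro a _ b _ hab
      rw [Function.onFun, Finset.disjoint_left]
      intro x hx hx'
      simp only [mem_filter, mem_univ, true_and] at hx hx'
      omega
  have h2 : ∑ t ∈ Finset.Ioc (3 * ρ) (4 * ρ), (ball G c (8 * ρ)).card <
      ∑ t ∈ Finset.Ioc (3 * ρ) (4 * ρ), (Finset.univ.filter (fun x => G.dist c x = t)).card * ρ := by
    apply Finset.sum_lt_sum_of_nonempty
    · exact ⟨4 * ρ, by simp; omega⟩
    · intro t ht
      simp only [mem_Ioc] at ht
      exact hc t ht.1 ht.2
  rw [← Finset.sum_mul, Finset.sum_const, Nat.card_Ioc, smul_eq_mul,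
    show 4 * ρ - 3 * ρ = ρ by omega] at h2
  nlinarith


/-- an edge of the middle part of the canonical path of the pair `q` -/
def Mid (hG : G.Connected) (D0 : ℕ) (q : V × V) (x y : V) : Prop :=
  G.Adj x y ∧ (x ∈ geo hG q.1 q.2 ∧ D0 ≤ G.dist q.1 x ∧ D0 ≤ G.dist x q.2) ∧
    (y ∈ geo hG q.1 q.2 ∧ D0 ≤ G.dist q.1 y ∧ D0 ≤ G.dist y q.2)

/-- the spanner built from trees in clusters and from the bought pairs `Q` -/
def HQ (hG : G.Connected) (C : Finset V) (ρ : V → ℕ) (par : V → V → V) (D0 : ℕ)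
    (Q : Finset (V × V)) : SimpleGraph V :=
  SimpleGraph.fromRel (fun x y =>
    (∃ c ∈ C, x ∈ ball G c (8 * ρ c) ∧ x ≠ c ∧ y = par c x) ∨ ∃ q ∈ Q, Mid hG D0 q x y)

def ParSpec (G : SimpleGraph V) (par : V → V → V) : Prop :=
  ∀ c x, x ≠ c → G.Adj x (par c x) ∧ G.dist c (par c x) + 1 = G.dist c x

lemma exists_par (hG : G.Connected) : ∃ par, ParSpec G par := by
  have : ∀ c x, ∃ y, x ≠ c → G.Adj x y ∧ G.dist c y + 1 = G.dist c x := by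
    intro c x
    by_cases h : x = c
    · exact ⟨x, fun h' => absurd h h'⟩
    · have h0 : G.dist c x ≠ 0 := fun h0 => h (hG.dist_eq_zero_iff.mp h0).symm
      obtain ⟨y, hy, e⟩ := (geo_is hG c x).surj (G.dist c x - 1) (by omega)
      have := (geo_is hG c x).on y hy
      refine ⟨y, fun _ => ⟨?_, by omega⟩⟩
      rw [← SimpleGraph.dist_eq_one_iff_adj, G.dist_comm]; omega
  choose par h using this
  exact ⟨par, h⟩

section core
variable (hG : G.Connected) {C : Finset V} {ρ : V → ℕ} {par : V → V → V} {D0 : ℕ}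
  {Q Q' : Finset (V × V)} (hpar : ParSpec G par)

include hpar in
lemma HQ_le : HQ hG C ρ par D0 Q ≤ G := by
  intro x y h
  rw [HQ, SimpleGraph.fromRel_adj] at h
  obtain ⟨_, (⟨c, _, _, hx, rfl⟩ | ⟨q, _, h⟩) | (⟨c, _, _, hx, rfl⟩ | ⟨q, _, h⟩)⟩ := h
  · exact (hpar c x hx).1
  · exact h.1
  · exact (hpar c y hx).1.symm
  · exact h.1.symm

lemma HQ_mono (h : Q ⊆ Q') : HQ hG C ρ par D0 Q ≤ HQ hG C ρ par D0 Q' := by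
  intro x y
  rw [HQ, HQ, SimpleGraph.fromRel_adj, SimpleGraph.fromRel_adj]
  rintro ⟨hne, (h1 | ⟨q, hq, h1⟩) | (h1 | ⟨q, hq, h1⟩)⟩
  · exact ⟨hne, Or.inl (Or.inl h1)⟩
  · exact ⟨hne, Or.inl (Or.inr ⟨q, h hq, h1⟩)⟩
  · exact ⟨hne, Or.inr (Or.inl h1)⟩
  · exact ⟨hne, Or.inr (Or.inr ⟨q, h hq, h1⟩)⟩

include hpar in
lemma tree_R {c : V} (hc : c ∈ C) (m : ℕ) : ∀ x, G.dist c x = m → m ≤ 8 * ρ c →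
    R (HQ hG C ρ par D0 Q) c x m := by
  induction m with
  | zero =>
    intro x hx _
    rw [hG.dist_eq_zero_iff] at hx
    subst hx
    exact R.refl _ _
  | succ m ih =>
    intro x hx hm
    have hne : x ≠ c := by rintro rfl; simp at hx
    obtain ⟨h1, h2⟩ := hpar c x hne
    refine (ih (par c x) (by omega) (by omega)).trans (R.adj ?_)
    rw [HQ, SimpleGraph.fromRel_adj]
    exact ⟨h1.ne', Or.inr (Or.inl ⟨c, hc, by rw [mem_ball]; omega, hne, rfl⟩)⟩

variable {r L : ℕ} (hρ : ∀ c ∈ C, r ≤ ρ c ∧ 8 * ρ c ≤ L * r)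
  (hcov : ∀ x, ∃ c ∈ C, G.dist c x ≤ 3 * ρ c)

include hpar hρ hcov in
lemma base_R (m : ℕ) : ∀ x y, G.dist x y ≤ m * r → R (HQ hG C ρ par D0 Q) x y (m * (L * r)) := by
  have one : ∀ x y, G.dist x y ≤ r → R (HQ hG C ρ par D0 Q) x y (L * r) := by
    intro x y hxy
    obtain ⟨c, hc, h⟩ := hcov x
    have h1 := hρ c hc
    have h2 := hG.dist_triangle (u := c) (v := x) (w := y)
    have a := tree_R (C := C) (ρ := ρ) (D0 := D0) (Q := Q) hG hpar hc _ x rfl (by omega)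
    have b := tree_R (C := C) (ρ := ρ) (D0 := D0) (Q := Q) hG hpar hc _ y rfl (by omega)
    exact (a.symm.trans b).mono (by omega)
  induction m with
  | zero =>
    intro x y h
    simp only [zero_mul, nonpos_iff_eq_zero] at h
    rw [hG.dist_eq_zero_iff] at h
    subst h
    exact (R.refl _ _).mono (by simp)
  | succ m ih =>
    intro x y h
    rw [add_mul, one_mul] at h ⊢
    by_cases hr : G.dist x y ≤ r
    · exact (one x y hr).mono (by omega)
    · obtain ⟨z, hz, e⟩ := (geo_is hG x y).surj r (by omega)
      have := (geo_is hG x y).on z hz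
      have a := one x z e.le
      have b := ih z y (by omega)
      exact (a.trans b).mono (by omega)

lemma mid_R {q : V × V} (hq : q ∈ Q) {x : V} (hx : x ∈ geo hG q.1 q.2) (hx1 : D0 ≤ G.dist q.1 x)
    (m : ℕ) : ∀ y ∈ geo hG q.1 q.2, D0 ≤ G.dist y q.2 →
    G.dist q.1 y = G.dist q.1 x + m → R (HQ hG C ρ par D0 Q) x y m := by
  have I := geo_is hG q.1 q.2
  induction m with
  | zero =>
    intro y hy _ e
    have := I.uniq hG hx hy (by omega)
    subst this
    exact R.refl _ _
  | succ m ih =>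
    intro y hy hy1 e
    have oy := I.on y hy
    obtain ⟨z, hz, ez⟩ := I.surj (G.dist q.1 x + m) (by omega)
    have oz := I.on z hz
    have hm := I.met z hz y hy (by omega)
    refine (ih z hz (by omega) ez).trans (R.adj ?_)
    have hadj : G.Adj z y := by
      rw [← SimpleGraph.dist_eq_one_iff_adj]; omega
    rw [HQ, SimpleGraph.fromRel_adj]
    exact ⟨hadj.ne, Or.inl (Or.inr ⟨q, hq, hadj, ⟨hz, by omega, by omega⟩, hy, by omega, by omega⟩)⟩

include hpar hρ hcov in
lemma sat_R {q : V × V} (hq : q ∈ Q) {x : V} (hx : x ∈ geo hG q.1 q.2) (hD : D0 = L * r)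
    (hx1 : D0 ≤ G.dist q.1 x) (hx2 : D0 ≤ G.dist x q.2) :
    R (HQ hG C ρ par D0 Q) q.1 x (G.dist q.1 x + L * (L * r)) ∧
    R (HQ hG C ρ par D0 Q) x q.2 (G.dist x q.2 + L * (L * r)) := by
  have I := geo_is hG q.1 q.2
  have ox := I.on x hx
  constructor
  · obtain ⟨x0, h0, e0⟩ := I.surj D0 (by omega)
    have a := base_R (D0 := D0) (Q := Q) hG hpar hρ hcov L q.1 x0 (by omega)
    have b := mid_R (C := C) (ρ := ρ) (par := par) hG hq h0 (by omega)
      (G.dist q.1 x - D0) x hx hx2 (by omega)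
    exact (a.trans b).mono (by omega)
  · obtain ⟨x0, h0, e0⟩ := I.surj (G.dist q.1 q.2 - D0) (by omega)
    have o0 := I.on x0 h0
    have a := base_R (D0 := D0) (Q := Q) hG hpar hρ hcov L x0 q.2 (by omega)
    have b := mid_R (C := C) (ρ := ρ) (par := par) hG hq hx hx1
      (G.dist q.1 x0 - G.dist q.1 x) x0 h0 (by omega) (by omega)
    exact (b.trans a).mono (by omega)

/-- the middle of the path of `q` meets the core of the cluster `c` -/
def Hits (hG : G.Connected) (ρ : V → ℕ) (D0 : ℕ) (c : V) (q : V × V) : Prop :=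
  ∃ x ∈ geo hG q.1 q.2, D0 ≤ G.dist q.1 x ∧ D0 ≤ G.dist x q.2 ∧ G.dist c x ≤ 3 * ρ c

include hpar hρ hcov in
lemma buying (S : Finset V) (hL : 1 ≤ L) (hD : D0 = L * r) : ∃ Q : Finset (V × V),
    (∀ c ∈ C, (Q.filter (Hits hG ρ D0 c)).card ≤ S.card) ∧
    ∀ u ∈ S, ∀ v ∈ S, R (HQ hG C ρ par D0 Q) u v (G.dist u v + 5 * (L * (L * r))) := by
  set good : Finset (V × V) → V → V → Prop := fun Q c z =>
    R (HQ hG C ρ par D0 Q) z c (G.dist z c + (L * (L * r) + L * r)) with hgood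
  have hLr : L * r ≤ L * (L * r) := Nat.le_mul_of_pos_left _ hL
  set Inv : Finset (V × V) → Prop := fun Q => Q ⊆ S ×ˢ S ∧
    ∀ c ∈ C, (Q.filter (Hits hG ρ D0 c)).card ≤ (S.filter (good Q c)).card with hInv
  obtain ⟨Q, hQ, hmax⟩ := Finset.exists_max_image (Finset.univ.filter Inv) Finset.card
    ⟨∅, by simp [hInv]⟩
  simp only [mem_filter, mem_univ, true_and] at hQ hmax
  refine ⟨Q, fun c hc => (hQ.2 c hc).trans (Finset.card_filter_le _ _), ?_⟩
  intro u hu v hv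
  by_contra hbad
  have hlong : ¬ (G.dist u v < 2 * D0) := by
    intro h
    apply hbad
    have := base_R (D0 := D0) (Q := Q) hG hpar hρ hcov (2 * L) u v (by rw [mul_assoc]; omega)
    rw [mul_assoc] at this
    exact this.mono (by omega)
  have hq : (u, v) ∉ Q := by
    intro hq
    apply hbad
    obtain ⟨x, hx, e⟩ := (geo_is hG u v).surj D0 (by omega)
    have o := (geo_is hG u v).on x hx
    obtain ⟨a, b⟩ := sat_R (Q := Q) (q := (u, v)) hG hpar hρ hcov hq hx hD (by simp only; omega)
      (by simp only; omega)
    simp only at a b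
    exact (a.trans b).mono (by omega)
  have hins : Inv (insert (u, v) Q) := by
    refine ⟨?_, ?_⟩
    · intro p hp
      rcases mem_insert.mp hp with rfl | hp
      · simp [hu, hv]
      · exact hQ.1 hp
    · intro c hc
      have hmono : S.filter (good Q c) ⊆ S.filter (good (insert (u, v) Q) c) := by
        intro z hz
        simp only [mem_filter] at hz ⊢
        exact ⟨hz.1, R.monoH hz.2 (HQ_mono hG (Finset.subset_insert _ _))⟩
      rw [Finset.filter_insert]
      split_ifs with hh
      · have hlt : S.filter (good Q c) ⊂ S.filter (good (insert (u, v) Q) c) := by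
          refine ⟨hmono, fun hsub => hbad ?_⟩
          obtain ⟨x, hx, h1, h2, h3⟩ := hh
          simp only at hx h1 h2
          obtain ⟨a, b⟩ := sat_R (Q := insert (u, v) Q) (q := (u, v)) hG hpar hρ hcov
            (mem_insert_self _ _) hx hD h1 h2
          simp only at a b
          have hr := hρ c hc
          have o := (geo_is hG u v).on x hx
          have t := tree_R (C := C) (ρ := ρ) (D0 := D0) (Q := insert (u, v) Q) hG hpar hc _ x rfl
            (by omega)
          have t1 := hG.dist_triangle (u := u) (v := c) (w := x)
          have t2 := hG.dist_triangle (u := x) (v := c) (w := v)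
          have t3 := hG.dist_triangle (u := u) (v := x) (w := c)
          have t4 := hG.dist_triangle (u := c) (v := x) (w := v)
          have s1 := G.dist_comm (u := x) (v := c)
          have s2 := G.dist_comm (u := v) (v := c)
          have gu : u ∈ S.filter (good (insert (u, v) Q) c) := by
            simp only [mem_filter]
            exact ⟨hu, (a.trans t.symm).mono (by omega)⟩
          have gv : v ∈ S.filter (good (insert (u, v) Q) c) := by
            simp only [mem_filter]
            exact ⟨hv, (b.symm.trans t.symm).mono (by omega)⟩
          have gu' := hsub gu
          have gv' := hsub gv
          simp only [mem_filter, hgood] at gu' gv'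
          exact (gu'.2.trans gv'.2.symm).mono (by omega)
        have := Finset.card_lt_card hlt
        have h2 := hQ.2 c hc
        exact (Finset.card_insert_le _ _).trans (by omega)
      · exact (hQ.2 c hc).trans (Finset.card_le_card hmono)
  have := hmax _ hins
  rw [Finset.card_insert_of_notMem hq] at this
  omega

lemma seg_ends {c : V} {q : V × V} {t : ℕ} (h : Hits hG ρ D0 c q) (ht : 3 * ρ c < t)
    (ht2 : 3 * ρ c + t < D0) : ∃ p : V × V, G.dist c p.1 = t ∧ G.dist c p.2 = t ∧
      ∀ x ∈ geo hG q.1 q.2, G.dist c x ≤ t → x ∈ geo hG p.1 p.2 := by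
  obtain ⟨x, hx, h1, h2, h3⟩ := h
  obtain ⟨u, v⟩ := q
  simp only at *
  have I := geo_is hG u v
  set F := (geo hG u v).filter (fun x => G.dist c x ≤ t) with hF
  have hne : F.Nonempty := ⟨x, by simp [hF, hx]; omega⟩
  obtain ⟨a, ha, hmin⟩ := Finset.exists_min_image F (G.dist u) hne
  obtain ⟨b, hb, hmax⟩ := Finset.exists_max_image F (G.dist u) hne
  simp only [hF, mem_filter, and_imp] at ha hb hmin hmax
  have oa := I.on a ha.1
  have ob := I.on b hb.1
  refine ⟨(a, b), ?_, ?_, ?_⟩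
  · by_contra hlt
    have t1 := hG.dist_triangle (u := u) (v := c) (w := x)
    have t2 := hG.dist_triangle (u := u) (v := a) (w := c)
    have s1 := G.dist_comm (u := a) (v := c)
    obtain ⟨a', ha', e⟩ := I.surj (G.dist u a - 1) (by omega)
    have m := I.met a' ha' a ha.1 (by omega)
    have t3 := hG.dist_triangle (u := c) (v := a) (w := a')
    have s3 := G.dist_comm (u := a) (v := a')
    have := hmin a' ha' (by simp only at hlt; omega)
    simp only at hlt
    omega
  · by_contra hlt
    have t1 := hG.dist_triangle (u := x) (v := c) (w := v)
    have t2 := hG.dist_triangle (u := c) (v := b) (w := v)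
    have s1 := G.dist_comm (u := x) (v := c)
    obtain ⟨b', hb', e⟩ := I.surj (G.dist u b + 1) (by simp only at hlt; omega)
    have m := I.met b hb.1 b' hb' (by omega)
    have t3 := hG.dist_triangle (u := c) (v := b) (w := b')
    have := hmax b' hb' (by simp only at hlt; omega)
    omega
  · intro z hz hzt
    rw [geo_seg hG ha.1 hb.1 (hmin b hb.1 hb.2)]
    simp only [mem_filter]
    exact ⟨hz, hmin z hz hzt, hmax z hz hzt⟩

include hG hρ hcov in
lemma core (S : Finset V) (hL : 1 ≤ L) (hr : 0 < r) : ∃ H : SimpleGraph V, H ≤ G ∧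
    (∀ u ∈ S, ∀ v ∈ S, R H u v (G.dist u v + 5 * (L * (L * r)))) ∧
    ∃ p w : V → ℕ, (∀ c ∈ C, p c ≤ S.card ∧ p c ≤ w c ^ 2 ∧ w c * ρ c ≤ (ball G c (8 * ρ c)).card) ∧
      (H.edgeSet.ncard : ℝ) ≤ ∑ c ∈ C, (4 * ((ball G c (8 * ρ c)).card : ℝ) +
        3 * p c * Real.sqrt ((ball G c (8 * ρ c)).card)) := by
  obtain ⟨par, hpar⟩ := exists_par hG
  obtain ⟨Q, hQ1, hQ2⟩ := buying (D0 := L * r) hG hpar hρ hcov S hL rfl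
  set D0 := L * r with hD0
  have hlay : ∀ c, ∃ t, c ∈ C → 3 * ρ c < t ∧ t ≤ 4 * ρ c ∧
      (Finset.univ.filter (fun x => G.dist c x = t)).card * ρ c ≤ (ball G c (8 * ρ c)).card := by
    intro c
    by_cases hc : c ∈ C
    · obtain ⟨t, ht⟩ := layer (G := G) c (ρ c) (by have := hρ c hc; omega)
      exact ⟨t, fun _ => ht⟩
    · exact ⟨0, fun h => absurd h hc⟩
  choose t ht using hlay
  have hends : ∀ c q, ∃ p : V × V, c ∈ C → Hits hG ρ D0 c q → G.dist c p.1 = t c ∧ G.dist c p.2 = t c ∧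
      ∀ x ∈ geo hG q.1 q.2, G.dist c x ≤ t c → x ∈ geo hG p.1 p.2 := by
    intro c q
    by_cases h : c ∈ C ∧ Hits hG ρ D0 c q
    · have h1 := ht c h.1
      have h2 := hρ c h.1
      obtain ⟨p, hp⟩ := seg_ends hG (t := t c) h.2 h1.1 (by omega)
      exact ⟨p, fun _ _ => hp⟩
    · exact ⟨q, fun h1 h2 => absurd ⟨h1, h2⟩ h⟩
  choose e he using hends
  set T : V → Finset (V × V) := fun c => (Q.filter (Hits hG ρ D0 c)).image (e c) with hT
  set B : V → Finset V := fun c => ball G c (8 * ρ c) with hB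
  set W : V → Finset V := fun c => Finset.univ.filter (fun x => G.dist c x = t c) with hW
  have hTB : ∀ c ∈ C, ∀ p ∈ T c, geo hG p.1 p.2 ⊆ B c := by
    intro c hc p hp z hz
    simp only [hT, mem_image, mem_filter] at hp
    obtain ⟨q, ⟨_, hq⟩, rfl⟩ := hp
    obtain ⟨h1, h2, _⟩ := he c q hc hq
    have h3 := ht c hc
    have o := (geo_is hG _ _).on z hz
    have t1 := hG.dist_triangle (u := (e c q).1) (v := c) (w := (e c q).2)
    have t2 := hG.dist_triangle (u := c) (v := (e c q).1) (w := z)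
    have t3 := hG.dist_triangle (u := c) (v := (e c q).2) (w := z)
    have s1 := G.dist_comm (u := (e c q).1) (v := c)
    have s2 := G.dist_comm (u := (e c q).2) (v := z)
    simp only [hB, mem_ball]
    omega
  refine ⟨HQ hG C ρ par D0 Q, HQ_le hG hpar, hQ2, fun c => (T c).card, fun c => (W c).card, ?_, ?_⟩
  · intro c hc
    refine ⟨Finset.card_image_le.trans (hQ1 c hc), ?_, (ht c hc).2.2⟩
    rw [sq, ← Finset.card_product]
    apply Finset.card_le_card
    intro p hp
    simp only [hT, mem_image, mem_filter] at hp
    obtain ⟨q, ⟨_, hq⟩, rfl⟩ := hp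
    obtain ⟨h1, h2, _⟩ := he c q hc hq
    simp [hW, h1, h2]
  · set DD : Finset (V × V) := C.biUnion (fun c => ((B c).image (fun x => (x, par c x)) ∪
      (B c).image (fun x => (par c x, x))) ∪ darts hG (T c)) with hDD
    have midm : ∀ q ∈ Q, ∀ x y, Mid hG D0 q x y → ∃ c ∈ C, (x, y) ∈ darts hG (T c) ∧
        (y, x) ∈ darts hG (T c) := by
      intro q hq x y h
      obtain ⟨hadj, ⟨x1, x2, x3⟩, y1, y2, y3⟩ := h
      obtain ⟨c, hc, hcx⟩ := hcov x
      have hh : Hits hG ρ D0 c q := ⟨x, x1, x2, x3, hcx⟩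
      obtain ⟨_, _, h3⟩ := he c q hc hh
      have h4 := ht c hc
      have h5 := SimpleGraph.dist_eq_one_iff_adj.mpr hadj
      have t1 := hG.dist_triangle (u := c) (v := x) (w := y)
      have gx := h3 x x1 (by omega)
      have gy := h3 y y1 (by omega)
      have hm : e c q ∈ T c := by
        simp only [hT, mem_image, mem_filter]
        exact ⟨q, ⟨hq, hh⟩, rfl⟩
      refine ⟨c, hc, ?_, ?_⟩
      · simp only [darts, mem_filter, mem_univ, true_and]
        exact ⟨hadj, e c q, hm, gx, gy⟩
      · simp only [darts, mem_filter, mem_univ, true_and]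
        exact ⟨hadj.symm, e c q, hm, gy, gx⟩
    have hsub : (HQ hG C ρ par D0 Q).edgeSet ⊆ ((DD.image (fun q => s(q.1, q.2)) : Finset (Sym2 V)) : Set (Sym2 V)) := by
      intro ed hed
      induction ed using Sym2.ind with
      | _ x y =>
      rw [SimpleGraph.mem_edgeSet, HQ, SimpleGraph.fromRel_adj] at hed
      rw [mem_coe, mem_image]
      refine ⟨(x, y), ?_, rfl⟩
      simp only [hDD, mem_biUnion, mem_union, mem_image]
      obtain ⟨_, (⟨c, hc, hx, _, rfl⟩ | ⟨q, hq, h⟩) | (⟨c, hc, hx, _, rfl⟩ | ⟨q, hq, h⟩)⟩ := hed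
      · exact ⟨c, hc, Or.inl (Or.inl ⟨x, hx, rfl⟩)⟩
      · obtain ⟨c, hc, h1, h2⟩ := midm q hq x y h
        exact ⟨c, hc, Or.inr h1⟩
      · exact ⟨c, hc, Or.inl (Or.inr ⟨y, hx, rfl⟩)⟩
      · obtain ⟨c, hc, h1, h2⟩ := midm q hq y x h
        exact ⟨c, hc, Or.inr h2⟩
    have h1 : (HQ hG C ρ par D0 Q).edgeSet.ncard ≤ DD.card := by
      refine (Set.ncard_le_ncard hsub (Finset.finite_toSet _)).trans ?_
      rw [Set.ncard_coe_finset]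
      exact Finset.card_image_le
    have h2 : DD.card ≤ ∑ c ∈ C, (2 * (B c).card + (darts hG (T c)).card) := by
      refine Finset.card_biUnion_le.trans (Finset.sum_le_sum fun c _ => ?_)
      have a1 := Finset.card_union_le ((B c).image (fun x => (x, par c x)) ∪
        (B c).image (fun x => (par c x, x))) (darts hG (T c))
      have a2 := Finset.card_union_le ((B c).image (fun x => (x, par c x)))
        ((B c).image (fun x => (par c x, x)))
      have a3 : ((B c).image (fun x => (x, par c x))).card ≤ (B c).card := Finset.card_image_le
      have a4 : ((B c).image (fun x => (par c x, x))).card ≤ (B c).card := Finset.card_image_le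
      omega
    have h3 : ((HQ hG C ρ par D0 Q).edgeSet.ncard : ℝ) ≤
        ∑ c ∈ C, (2 * ((B c).card : ℝ) + ((darts hG (T c)).card : ℝ)) := by
      exact_mod_cast h1.trans h2
    refine h3.trans (Finset.sum_le_sum fun c hc => ?_)
    have := ce hG (B c) (T c) (hTB c hc)
    linarith

end core

lemma term_bound (s p w b ρ r : ℝ) (hs : 0 ≤ s) (hp : 0 ≤ p) (hw : 0 ≤ w) (hb : 0 ≤ b) (hr : 0 < r)
    (hρ : r ≤ ρ) (h1 : p ≤ s) (h2 : p ≤ w ^ 2) (h3 : w * ρ ≤ b) :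
    p * Real.sqrt b ≤ s ^ ((3 : ℝ) / 4) * b * r ^ (-(1 / 2) : ℝ) := by
  have e1 : p ≤ s ^ ((3 : ℝ) / 4) * w ^ ((1 : ℝ) / 2) := by
    have : p = p ^ ((3 : ℝ) / 4) * p ^ ((1 : ℝ) / 4) := by
      rw [← Real.rpow_add_of_nonneg hp (by norm_num) (by norm_num)]; norm_num
    rw [this]
    have h5 : p ^ ((1 : ℝ) / 4) ≤ w ^ ((1 : ℝ) / 2) := by
      calc p ^ ((1 : ℝ) / 4) ≤ (w ^ 2) ^ ((1 : ℝ) / 4) := Real.rpow_le_rpow hp h2 (by norm_num)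
        _ = w ^ ((1 : ℝ) / 2) := by
          rw [← Real.rpow_natCast, ← Real.rpow_mul hw]; norm_num
    exact mul_le_mul (Real.rpow_le_rpow hp h1 (by norm_num)) h5 (by positivity) (by positivity)
  have e2 : w ≤ b * r⁻¹ := by
    rw [← div_eq_mul_inv, le_div_iff₀ hr]
    exact (mul_le_mul_of_nonneg_left hρ hw).trans h3
  have e3 : w ^ ((1 : ℝ) / 2) ≤ Real.sqrt b * r ^ (-(1 / 2) : ℝ) := by
    calc w ^ ((1 : ℝ) / 2) ≤ (b * r⁻¹) ^ ((1 : ℝ) / 2) := Real.rpow_le_rpow hw e2 (by norm_num)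
      _ = _ := by
        rw [Real.mul_rpow hb (by positivity), Real.sqrt_eq_rpow, Real.inv_rpow hr.le,
          Real.rpow_neg hr.le]
  have hsb := Real.sqrt_nonneg b
  calc p * Real.sqrt b ≤ (s ^ ((3 : ℝ) / 4) * (Real.sqrt b * r ^ (-(1 / 2) : ℝ))) * Real.sqrt b := by
        apply mul_le_mul_of_nonneg_right _ hsb
        exact e1.trans (mul_le_mul_of_nonneg_left e3 (by positivity))
    _ = s ^ ((3 : ℝ) / 4) * (Real.sqrt b * Real.sqrt b) * r ^ (-(1 / 2) : ℝ) := by ring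
    _ = _ := by rw [Real.mul_self_sqrt hb]


end SubSpan

open SubSpan in
/-- **Unconditional sparse subset spanners.** For every `d > 0` and `ε > 0` there is a
constant `C` such that every connected graph `G` on `n` vertices and every vertex subset
`S` admit a subgraph `H` with `δ_H(u,v) ≤ δ_G(u,v) + n^d` for all `u, v ∈ S`, having at
most `C · (n^(1+ε) + |S|^(3/4) · n^(1-d/2+ε))` edges. -/
theorem subset_spanner_unconditional (d : ℝ) (hd : 0 < d) (ε : ℝ) (hε : 0 < ε) :
    ∃ C : ℝ, 0 < C ∧
      ∀ (V : Type) [Fintype V] (G : SimpleGraph V), G.Connected →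
        ∀ S : Finset V,
        ∃ H : SimpleGraph V, H ≤ G ∧
          (∀ u ∈ S, ∀ v ∈ S, H.Reachable u v ∧
            (H.dist u v : ℝ) ≤ (G.dist u v : ℝ) + (Fintype.card V : ℝ) ^ d) ∧
          (H.edgeSet.ncard : ℝ) ≤
            C * ((Fintype.card V : ℝ) ^ (1 + ε) +
              (S.card : ℝ) ^ ((3 : ℝ) / 4) *
                (Fintype.card V : ℝ) ^ (1 - d / 2 + ε)) := by
  obtain ⟨k, hk⟩ := exists_nat_gt (1 / ε)
  have hk0 : 0 < k := by
    have : (0 : ℝ) < k := lt_trans (by positivity) hk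
    exact_mod_cast this
  have hkε : (1 : ℝ) / k ≤ ε := by
    rw [div_le_iff₀ (by positivity)]
    rw [div_lt_iff₀ hε] at hk
    linarith
  set L : ℕ := 8 ^ k with hL
  have hL1 : 1 ≤ L := Nat.one_le_pow _ _ (by norm_num)
  -- `A = 5 L²` is the error in units of `r`
  set A : ℝ := 5 * (L * L) with hA
  have hA0 : 0 < A := by positivity
  set N0 : ℝ := A ^ (1 / d) with hN0
  have hN0' : 0 < N0 := by positivity
  set B : ℝ := (1 / (2 * A)) ^ (-(1 / 2) : ℝ) with hB
  have hB0 : 0 < B := by positivity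
  refine ⟨N0 ^ 2 + 4 + 3 * B, by positivity, ?_⟩
  intro V _ G hG S
  have hn : 0 < Fintype.card V := Fintype.card_pos_iff.mpr hG.nonempty
  set n : ℝ := ((Fintype.card V : ℕ) : ℝ) with hnn
  have hn1 : 1 ≤ n := by rw [hnn]; exact_mod_cast hn
  have hn0 : 0 < n := by linarith
  have hS0 : (0 : ℝ) ≤ (S.card : ℝ) ^ ((3 : ℝ) / 4) := by positivity
  have hX : 0 ≤ (S.card : ℝ) ^ ((3 : ℝ) / 4) * n ^ (1 - d / 2 + ε) := by positivity
  by_cases hsmall : n ^ d < A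
  · refine ⟨G, le_refl _, ?_, ?_⟩
    · intro u _ v _
      refine ⟨hG.preconnected u v, ?_⟩
      have : 0 ≤ n ^ d := by positivity
      linarith
    · have hnN : n ≤ N0 := by
        calc n = (n ^ d) ^ (1 / d) := by
              rw [← Real.rpow_mul hn0.le, mul_one_div_cancel hd.ne', Real.rpow_one]
          _ ≤ _ := Real.rpow_le_rpow (by positivity) hsmall.le (by positivity)
      have h1 : G.edgeSet.ncard ≤ Fintype.card V ^ 2 := by
        classical
        have hsub : G.edgeSet ⊆ (((Finset.univ : Finset (V × V)).image (fun q => s(q.1, q.2)) :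
            Finset (Sym2 V)) : Set (Sym2 V)) := by
          intro ed _
          induction ed using Sym2.ind with
          | _ x y =>
          rw [Finset.mem_coe, Finset.mem_image]
          exact ⟨(x, y), Finset.mem_univ _, rfl⟩
        refine (Set.ncard_le_ncard hsub (Finset.finite_toSet _)).trans ?_
        rw [Set.ncard_coe_finset]
        refine Finset.card_image_le.trans ?_
        rw [Finset.card_univ, Fintype.card_prod, sq]
      have h2 : (G.edgeSet.ncard : ℝ) ≤ n ^ 2 := by rw [hnn]; exact_mod_cast h1
      have h3 : n ^ 2 ≤ N0 ^ 2 := by gcongr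
      have h4 : 1 ≤ n ^ (1 + ε) := Real.one_le_rpow hn1 (by positivity)
      have h5 : 0 ≤ N0 ^ 2 := by positivity
      nlinarith [mul_nonneg (show (0:ℝ) ≤ N0 ^ 2 + 4 + 3 * B by positivity) hX]
  push Not at hsmall
  set r : ℕ := ⌊n ^ d / A⌋₊ with hr
  have hr1 : 1 ≤ r := by
    rw [hr, Nat.one_le_floor_iff, le_div_iff₀ hA0]
    linarith
  have hrle : (r : ℝ) * A ≤ n ^ d := by
    rw [← le_div_iff₀ hA0]
    exact Nat.floor_le (by positivity)
  have hrge : n ^ d / (2 * A) ≤ r := by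
    have h1 := Nat.lt_floor_add_one (n ^ d / A)
    rw [← hr] at h1
    have h2 : (1 : ℝ) ≤ r := by exact_mod_cast hr1
    rw [div_le_iff₀ (by positivity)]
    rw [div_lt_iff₀ hA0] at h1
    nlinarith
  have hr0 : (0 : ℝ) < r := by exact_mod_cast hr1
  obtain ⟨C, ρ, hρ, hcov, hsum⟩ := clusters hG k r hk0
  obtain ⟨H, hHG, hR, p, w, hpw, hcount⟩ := core hG hρ hcov S hL1 hr1
  refine ⟨H, hHG, ?_, ?_⟩
  · intro u hu v hv
    have h := hR u hu v hv
    refine ⟨⟨h.choose⟩, ?_⟩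
    have h1 : (H.dist u v : ℝ) ≤ ((G.dist u v + 5 * (L * (L * r)) : ℕ) : ℝ) := by
      exact_mod_cast h.dist_le
    push_cast at h1
    have : (5 : ℝ) * (L * (L * r)) = r * A := by rw [hA]; ring
    linarith
  · have hrh : (r : ℝ) ^ (-(1 / 2) : ℝ) ≤ B * n ^ (-(d / 2)) := by
      calc (r : ℝ) ^ (-(1 / 2) : ℝ) ≤ (n ^ d / (2 * A)) ^ (-(1 / 2) : ℝ) :=
            Real.rpow_le_rpow_of_nonpos (by positivity) hrge (by norm_num)
        _ = B * n ^ (-(d / 2)) := by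
            rw [div_eq_mul_one_div, Real.mul_rpow (by positivity) (by positivity),
              ← Real.rpow_mul hn0.le, mul_comm]
            congr 2
            ring
    have hn2 : n ^ (1 + (1 : ℝ) / k) ≤ n ^ (1 + ε) :=
      Real.rpow_le_rpow_of_exponent_le hn1 (by linarith)
    set M : ℝ := ∑ c ∈ C, ((ball G c (8 * ρ c)).card : ℝ) with hM
    have hM0 : 0 ≤ M := Finset.sum_nonneg fun _ _ => by positivity
    have hMn : M ≤ n ^ (1 + ε) := hsum.trans hn2
    have h1 : (H.edgeSet.ncard : ℝ) ≤
        (4 + 3 * ((S.card : ℝ) ^ ((3 : ℝ) / 4) * (r : ℝ) ^ (-(1 / 2) : ℝ))) * M := by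
      refine hcount.trans ?_
      rw [hM, Finset.mul_sum]
      apply Finset.sum_le_sum
      intro c hc
      obtain ⟨a1, a2, a3⟩ := hpw c hc
      have := term_bound (S.card) (p c) (w c) ((ball G c (8 * ρ c)).card) (ρ c) r
        (by positivity) (by positivity) (by positivity) (by positivity) hr0
        (by exact_mod_cast (hρ c hc).1) (by exact_mod_cast a1) (by exact_mod_cast a2)
        (by exact_mod_cast a3)
      nlinarith
    have h2 : (S.card : ℝ) ^ ((3 : ℝ) / 4) * (r : ℝ) ^ (-(1 / 2) : ℝ) * M ≤
        B * ((S.card : ℝ) ^ ((3 : ℝ) / 4) * n ^ (1 - d / 2 + ε)) := by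
      calc (S.card : ℝ) ^ ((3 : ℝ) / 4) * (r : ℝ) ^ (-(1 / 2) : ℝ) * M
          ≤ (S.card : ℝ) ^ ((3 : ℝ) / 4) * (B * n ^ (-(d / 2))) * n ^ (1 + ε) := by
            apply mul_le_mul _ hMn hM0 (by positivity)
            exact mul_le_mul_of_nonneg_left hrh hS0
        _ = B * ((S.card : ℝ) ^ ((3 : ℝ) / 4) * (n ^ (-(d / 2)) * n ^ (1 + ε))) := by ring
        _ = _ := by
            rw [← Real.rpow_add hn0]
            congr 3
            ring
    have hY : 0 ≤ n ^ (1 + ε) := by positivity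
    have hN2 : 0 ≤ N0 ^ 2 := by positivity
    generalize (S.card : ℝ) ^ ((3 : ℝ) / 4) * n ^ (1 - d / 2 + ε) = X at *
    generalize n ^ (1 + ε) = Y at *
    have k1 : 0 ≤ N0 ^ 2 * (X + Y) := by positivity
    have k2 : 0 ≤ B * Y := by positivity
    linarith
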